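/- Suppose (G_n) satisfies Assumption 1 and set Γ_n = c_0 · T_mix(G_n) · log|V_n| where the universal constant c_0 is sufficiently large. Then there is a constant C > 0 such that for all n and all x, y, z ∈ V_n: | P_{x,z}[ Γ_n < τ_1(y) < τ_2(y) ] − P_{x,z}[ Γ_n < τ_2(y) < τ_1(y) ] | ≤ C · |V_n|^{−100}. -/

import Mathlib

open MeasureTheory ProbabilityTheory Filter

attribute [local instance] Classical.propDecidable

noncomputable section

namespace RWPaint

variable {V : Type*} [Fintype V]

/-- The degree of a vertex. -/
def deg (G : SimpleGraph V) (x : V) : ℕ := (Finset.univ.filter fun y => G.Adj x y).card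

/-- One-step transition kernel of the lazy random walk on a finite graph:
holding probability `1/2`, otherwise a uniformly chosen neighbour. -/
def K (G : SimpleGraph V) (x y : V) : ℝ :=
  if x = y then (if deg G x = 0 then 1 else 1 / 2)
  else if G.Adj x y then 1 / (2 * (deg G x : ℝ)) else 0

/-- The `t`-step transition kernel. -/
def Kpow (G : SimpleGraph V) : ℕ → V → V → ℝ
  | 0 => fun x y => if x = y then 1 else 0
  | t + 1 => fun x y => ∑ z, Kpow G t x z * K G z y

/-- The uniform (stationary) probability of a single vertex. -/
def unif (V : Type*) [Fintype V] : ℝ := (Fintype.card V : ℝ)⁻¹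

/-- The uniform mixing time. -/
def Tmix (G : SimpleGraph V) : ℕ :=
  sInf {t : ℕ | ∀ x y : V, |Kpow G t x y / unif V - 1| ≤ 1 / 4}

/-- The Green's function `g(x,y) = ∑_{t=0}^{Tmix} p^t(x,y)`. -/
def green (G : SimpleGraph V) (x y : V) : ℝ :=
  ∑ t ∈ Finset.range (Tmix G + 1), Kpow G t x y

/-- The kernel killed on (entering) the set `S`. -/
def Kkill (G : SimpleGraph V) (S : Finset V) (x y : V) : ℝ :=
  if y ∈ S then 0 else K G x y

/-- Powers of the killed kernel. -/
def KkillPow (G : SimpleGraph V) (S : Finset V) : ℕ → V → V → ℝ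
  | 0 => fun x y => if x = y then 1 else 0
  | t + 1 => fun x y => ∑ z, KkillPow G S t x z * Kkill G S z y

/-- `P_x[τ(S) ≤ T]`, the probability that the lazy walk started at `x` visits `S`
by time `T`. -/
def hitBy (G : SimpleGraph V) (S : Finset V) (x : V) (T : ℕ) : ℝ :=
  if x ∈ S then 1 else 1 - ∑ z, KkillPow G S T x z

/-- `f_{n,c}(x,y) = P_x[τ(y) ≤ c T_mix]`. -/
def fnc (G : SimpleGraph V) (c : ℝ) (x y : V) : ℝ :=
  hitBy G {y} x ⌊c * (Tmix G : ℝ)⌋₊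

/-- `f̄_{n,c} = ∑_y f_{n,c}(x,y) π(y)` (averaged also over `x`; by vertex
transitivity this agrees with the value for any fixed `x`). -/
def fbar (G : SimpleGraph V) (c : ℝ) : ℝ :=
  (∑ x : V, ∑ y : V, fnc G c x y) / (Fintype.card V : ℝ) ^ 2

/-- `F_{n,c} = ∑_{x,y} (f_{n,c}(x,y) - f̄_{n,c})^2`. -/
def Fquad (G : SimpleGraph V) (c : ℝ) : ℝ :=
  ∑ x : V, ∑ y : V, (fnc G c x y - fbar G c) ^ 2

/-- `Γ_n = c₀ T_mix log |V|`. -/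
def gammaTime (G : SimpleGraph V) (c₀ : ℝ) : ℕ :=
  ⌊c₀ * (Tmix G : ℝ) * Real.log (Fintype.card V)⌋₊

/-- `P_x[X_t = z | τ(y) ≥ t]` as a combinatorial formula (meaningful for
`x ≠ y` and `t ≥ 1`). -/
def condAtProb (G : SimpleGraph V) (y x z : V) (t : ℕ) : ℝ :=
  (∑ w, KkillPow G {y} (t - 1) x w * K G w z) / (∑ w, KkillPow G {y} (t - 1) x w)

/-- `∑_{t=0}^{c T_mix} p^t(x,y)`. -/
def greenC (G : SimpleGraph V) (c : ℝ) (x y : V) : ℝ :=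
  ∑ t ∈ Finset.range (⌊c * (Tmix G : ℝ)⌋₊ + 1), Kpow G t x y

/-- A graph is vertex transitive if its automorphism group acts transitively. -/
def IsVertexTransitive (G : SimpleGraph V) : Prop :=
  ∀ x y : V, ∃ e : G ≃g G, e x = y

/-- The probability of a trajectory prefix for the lazy walk with initial
distribution `init`. -/
def walkP (G : SimpleGraph V) (init : V → ℝ) (n : ℕ) (v : ℕ → V) : ℝ :=
  init (v 0) * ∏ i ∈ Finset.range n, K G (v i) (v (i + 1))

/-- Point mass initial distribution. -/
def delta (x : V) : V → ℝ := fun y => if y = x then 1 else 0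

/-- Uniform initial distribution. -/
def uinit (V : Type*) [Fintype V] : V → ℝ := fun _ => (Fintype.card V : ℝ)⁻¹

/-- `X₁, X₂` are independent lazy random walks on `G` with initial
distributions `init₁, init₂`, defined on the probability space `(Ω, P)`:
all finite-dimensional distributions factorize as products of trajectory-prefix
probabilities. -/
structure IsWalkPair {Ω : Type*} [MeasurableSpace Ω] (G : SimpleGraph V) (P : Measure Ω)
    (X₁ X₂ : ℕ → Ω → V) (init₁ init₂ : V → ℝ) : Prop where
  meas₁ : ∀ (t : ℕ) (x : V), MeasurableSet {ω | X₁ t ω = x}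
  meas₂ : ∀ (t : ℕ) (x : V), MeasurableSet {ω | X₂ t ω = x}
  law : ∀ (n : ℕ) (v w : ℕ → V),
    (P {ω | (∀ i ≤ n, X₁ i ω = v i) ∧ ∀ i ≤ n, X₂ i ω = w i}).toReal
      = walkP G init₁ n v * walkP G init₂ n w

/-- `X₁, X₂` are independent stationary lazy random walks on `G`, together with
a family `ξ` of independent fair coins (one per vertex, used to break ties),
all defined on the probability space `(Ω, P)`. -/
structure IsPaintSetup {Ω : Type*} [MeasurableSpace Ω] (G : SimpleGraph V) (P : Measure Ω)
    (X₁ X₂ : ℕ → Ω → V) (ξ : V → Ω → Bool) : Prop where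
  meas₁ : ∀ (t : ℕ) (x : V), MeasurableSet {ω | X₁ t ω = x}
  meas₂ : ∀ (t : ℕ) (x : V), MeasurableSet {ω | X₂ t ω = x}
  measξ : ∀ x : V, MeasurableSet {ω | ξ x ω = true}
  law : ∀ (n : ℕ) (v w : ℕ → V) (b : V → Bool),
    (P {ω | ((∀ i ≤ n, X₁ i ω = v i) ∧ ∀ i ≤ n, X₂ i ω = w i) ∧ ∀ x, ξ x ω = b x}).toReal
      = walkP G (uinit V) n v * walkP G (uinit V) n w * (1 / 2) ^ Fintype.card V

/-- The hitting time `τ(x)` of a vertex `x` (with value `⊤` if `x` is never visited). -/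
def hitTime {Ω : Type*} (X : ℕ → Ω → V) (x : V) (ω : Ω) : ℕ∞ :=
  ⨅ (s : ℕ) (_ : X s ω = x), (s : ℕ∞)

/-- `τ(x,y) = τ(x) ⊓ τ(y)`. -/
def hitTime2 {Ω : Type*} (X : ℕ → Ω → V) (x y : V) (ω : Ω) : ℕ∞ :=
  min (hitTime X x ω) (hitTime X y ω)

/-- `|𝒜₁|`: the number of vertices first visited by `X₁` (ties broken by the coins `ξ`). -/
def paintedCount {Ω : Type*} (X₁ X₂ : ℕ → Ω → V) (ξ : V → Ω → Bool) (ω : Ω) : ℕ :=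
  Nat.card {x : V // hitTime X₁ x ω < hitTime X₂ x ω ∨
    (hitTime X₁ x ω = hitTime X₂ x ω ∧ ξ x ω = true)}

/-- The event `H(x,y) = {τ₁(x) < min(τ₁(y), τ₂(x), τ₂(y))}`. -/
def Hevent {Ω : Type*} (X₁ X₂ : ℕ → Ω → V) (x y : V) : Set Ω :=
  {ω | hitTime X₁ x ω < min (hitTime X₁ y ω) (min (hitTime X₂ x ω) (hitTime X₂ y ω))}

/-- `Y₂ = X₂(τ₁(x,y))`. -/
def Ytwo {Ω : Type*} (X₁ X₂ : ℕ → Ω → V) (x y : V) (ω : Ω) : V :=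
  X₂ (hitTime2 X₁ x y ω).toNat ω

/-- `π̃(z;x,y) = P[X₂(τ₁(x,y)) = z | H(x,y)]`. -/
def pitilde {Ω : Type*} [MeasurableSpace Ω] (P : Measure Ω) (X₁ X₂ : ℕ → Ω → V) (x y z : V) : ℝ :=
  (P (Hevent X₁ X₂ x y ∩ {ω | Ytwo X₁ X₂ x y ω = z})).toReal
    / (P (Hevent X₁ X₂ x y)).toReal

/-- The event `A(x,y) = {τ₁(x,y) ≥ τ₂(x,y) > τ₁(x,y) - Γ, τ₁(x) < τ₁(y)}`. -/
def Aevent {Ω : Type*} (X₁ X₂ : ℕ → Ω → V) (x y : V) (Γ : ℕ) : Set Ω :=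
  {ω | hitTime2 X₂ x y ω ≤ hitTime2 X₁ x y ω ∧
    hitTime2 X₁ x y ω - (Γ : ℕ∞) < hitTime2 X₂ x y ω ∧
    hitTime X₁ x ω < hitTime X₁ y ω}

/-- Conditional probability `P[A | B]`. -/
def condGiven {Ω : Type*} [MeasurableSpace Ω] (P : Measure Ω) (A B : Set Ω) : ℝ :=
  (P (A ∩ B)).toReal / (P B).toReal

/-- Assumption 1 of the paper. -/
structure Assumption1 (V : ℕ → Type*) [∀ n, Fintype (V n)]
    (G : ∀ n, SimpleGraph (V n)) : Prop where
  conn : ∀ n, (G n).Connected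
  vt : ∀ n, IsVertexTransitive (G n)
  card_top : Tendsto (fun n => Fintype.card (V n)) atTop atTop
  tmix_small : Tendsto (fun n =>
    (Tmix (G n) : ℝ) * (Real.log (Fintype.card (V n))) ^ 2 / (Fintype.card (V n) : ℝ))
    atTop (nhds 0)
  tmix_top : Tendsto (fun n => Tmix (G n)) atTop atTop
  green_sq_small : ∃ ε : ℕ → ℝ, Tendsto ε atTop (nhds 0) ∧
    ∀ n, ∀ x : V n, ∑ y ∈ Finset.univ.erase x, (green (G n) x y) ^ 2
      ≤ ε n * (Tmix (G n) : ℝ) / Real.log (Fintype.card (V n))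
  hit_miss : ∃ ρ : ℝ, ρ < 1 ∧ ∀ n, ∀ x y z : V n, x ≠ y → x ≠ z → y ≠ z →
    hitBy (G n) {y, z} x (Tmix (G n)) ≤ ρ

/-- The discrete torus `ℤ_n^d`. -/
def torus (d n : ℕ) : SimpleGraph (Fin d → ZMod n) where
  Adj x y := x ≠ y ∧ ∃ i, y - x = Pi.single i 1 ∨ x - y = Pi.single i 1
  symm := by
    constructor
    rintro x y ⟨hne, i, h | h⟩
    · exact ⟨hne.symm, i, Or.inr h⟩
    · exact ⟨hne.symm, i, Or.inl h⟩
  loopless := ⟨fun x h => h.1 rfl⟩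

/-- The hypercube `ℤ_2^n`. -/
def hypercube (n : ℕ) : SimpleGraph (Fin n → Bool) where
  Adj x y := x ≠ y ∧ ∃ i, ∀ j, j ≠ i → x j = y j
  symm := by
    constructor
    rintro x y ⟨hne, i, h⟩
    exact ⟨hne.symm, i, fun j hj => (h j hj).symm⟩
  loopless := ⟨fun x h => h.1 rfl⟩

/-- The Cayley graph of the symmetric group `S_n` generated by the transpositions. -/
def transpositionGraph (n : ℕ) : SimpleGraph (Equiv.Perm (Fin n)) where
  Adj σ τ := (σ * τ⁻¹).IsSwap
  symm := by
    constructor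
    rintro σ τ ⟨a, b, hab, h⟩
    exact ⟨a, b, hab, by rw [show τ * σ⁻¹ = (σ * τ⁻¹)⁻¹ by group, h, Equiv.swap_inv]⟩
  loopless := by
    constructor
    intro σ h
    obtain ⟨a, b, hab, h⟩ := h
    rw [mul_inv_cancel] at h
    exact hab (by simpa [Equiv.swap_apply_left] using Equiv.ext_iff.mp h a)

/-- One-step kernel of the lazy simple random walk on `ℤ^d`. -/
def KZ (d : ℕ) (x y : Fin d → ℤ) : ℝ :=
  if x = y then 1 / 2
  else if ∃ i, y - x = Pi.single i 1 ∨ x - y = Pi.single i 1 then 1 / (4 * d) else 0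

/-- `t`-step kernel of the lazy simple random walk on `ℤ^d`. -/
def KZpow (d : ℕ) : ℕ → (Fin d → ℤ) → (Fin d → ℤ) → ℝ
  | 0 => fun x y => if x = y then 1 else 0
  | t + 1 => fun x y => ∑' z, KZpow d t x z * KZ d z y

/-- The Green's function `G(x; ℤ^d) = ∑_{t=0}^∞ p^t(0,x)` of the lazy walk on `ℤ^d`. -/
def greenZ (d : ℕ) (x : Fin d → ℤ) : ℝ := ∑' t : ℕ, KZpow d t 0 x

/-- `α_d` for `d ≥ 5`. -/
def alphaHigh (d : ℕ) : ℝ := (∑' y : Fin d → ℤ, (greenZ d y) ^ 2) / (greenZ d 0) ^ 2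

/-- The normalization `h_d(n)`. -/
def hfun (d n : ℕ) : ℝ :=
  if d = 3 then (n : ℝ) ^ 4
  else if d = 4 then (n : ℝ) ^ 4 * Real.log n
  else (n : ℝ) ^ d

/-- Matrix powers of an abstract kernel. -/
def mpow (p : V → V → ℝ) : ℕ → V → V → ℝ
  | 0 => fun x y => if x = y then 1 else 0
  | t + 1 => fun x y => ∑ z, mpow p t x z * p z y

/-- Total variation distance between two (probability) vectors. -/
def tvDist (μ ν : V → ℝ) : ℝ := (1 / 2) * ∑ x, |μ x - ν x|


/-! ### Wedge contraction -/

/-- Bound on the second exterior power of a matrix. -/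
def WB (A : Matrix V V ℝ) (θ : ℝ) : Prop :=
  ∀ u v, ∑ a, ∑ b, |A u a * A v b - A u b * A v a| ≤ 2 * θ

lemma WB_one : WB (1 : Matrix V V ℝ) 1 := by
  intro u v
  calc ∑ a, ∑ b, |(1 : Matrix V V ℝ) u a * (1 : Matrix V V ℝ) v b
        - (1 : Matrix V V ℝ) u b * (1 : Matrix V V ℝ) v a|
      ≤ ∑ a, ∑ b, ((1 : Matrix V V ℝ) u a * (1 : Matrix V V ℝ) v b
        + (1 : Matrix V V ℝ) u b * (1 : Matrix V V ℝ) v a) := by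
        refine Finset.sum_le_sum fun a _ => Finset.sum_le_sum fun b _ => ?_
        have h : ∀ i j, 0 ≤ (1 : Matrix V V ℝ) i j := by
          intro i j; rw [Matrix.one_apply]; split_ifs <;> norm_num
        rw [abs_le]
        have h1 := mul_nonneg (h u a) (h v b)
        have h2 := mul_nonneg (h u b) (h v a)
        constructor <;> linarith
    _ = 2 * 1 := by
        simp [Finset.sum_add_distrib, Matrix.one_apply]
        norm_num

lemma wedge_id (f g : V → ℝ) (B : V → V → ℝ) (hB : ∀ c d, B c d = - B d c) :
    2 * ∑ c, ∑ d, f c * g d * B c d = ∑ c, ∑ d, (f c * g d - f d * g c) * B c d := by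
  have h : ∑ c, ∑ d, f d * g c * B c d = - ∑ c, ∑ d, f c * g d * B c d := by
    rw [Finset.sum_comm, ← Finset.sum_neg_distrib]
    refine Finset.sum_congr rfl fun c _ => ?_
    rw [← Finset.sum_neg_distrib]
    refine Finset.sum_congr rfl fun d _ => ?_
    rw [hB d c]; ring
  simp only [sub_mul, Finset.sum_sub_distrib]
  rw [h]; ring

lemma WB_mul {A B : Matrix V V ℝ} {α β : ℝ} (hA : WB A α) (hB : WB B β) (hβ : 0 ≤ β) :
    WB (A * B) (α * β) := by
  intro u v
  have key : ∀ a b, 2 * ((A * B) u a * (A * B) v b - (A * B) u b * (A * B) v a)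
      = ∑ c, ∑ d, (A u c * A v d - A u d * A v c) * (B c a * B d b - B c b * B d a) := by
    intro a b
    rw [← wedge_id (A u) (A v) (fun c d => B c a * B d b - B c b * B d a)
      (fun c d => by ring)]
    congr 1
    simp only [Matrix.mul_apply, Finset.sum_mul_sum, ← Finset.sum_sub_distrib]
    refine Finset.sum_congr rfl fun c _ => Finset.sum_congr rfl fun d _ => ?_
    ring
  have h2 : ∀ a b, 2 * |(A * B) u a * (A * B) v b - (A * B) u b * (A * B) v a|
      ≤ ∑ c, ∑ d, |A u c * A v d - A u d * A v c| * |B c a * B d b - B c b * B d a| := by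
    intro a b
    have : 2 * |(A * B) u a * (A * B) v b - (A * B) u b * (A * B) v a|
        = |2 * ((A * B) u a * (A * B) v b - (A * B) u b * (A * B) v a)| := by
      rw [abs_mul]; norm_num
    rw [this, key]
    refine (Finset.abs_sum_le_sum_abs _ _).trans (Finset.sum_le_sum fun c _ => ?_)
    refine (Finset.abs_sum_le_sum_abs _ _).trans (Finset.sum_le_sum fun d _ => ?_)
    rw [abs_mul]
  have h3 : 2 * ∑ a, ∑ b, |(A * B) u a * (A * B) v b - (A * B) u b * (A * B) v a|
      ≤ ∑ c, ∑ d, |A u c * A v d - A u d * A v c| *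
          ∑ a, ∑ b, |B c a * B d b - B c b * B d a| := by
    calc _ ≤ ∑ a, ∑ b, ∑ c, ∑ d, |A u c * A v d - A u d * A v c| *
            |B c a * B d b - B c b * B d a| := by
          rw [Finset.mul_sum]
          refine Finset.sum_le_sum fun a _ => ?_
          rw [Finset.mul_sum]
          exact Finset.sum_le_sum fun b _ => h2 a b
      _ = ∑ q : V × V, ∑ p : V × V, |A u p.1 * A v p.2 - A u p.2 * A v p.1| *
            |B p.1 q.1 * B p.2 q.2 - B p.1 q.2 * B p.2 q.1| := by
          simp only [Fintype.sum_prod_type]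
      _ = _ := by
          rw [Finset.sum_comm]
          simp only [Fintype.sum_prod_type, Finset.mul_sum]
  have h4 : ∑ c, ∑ d, |A u c * A v d - A u d * A v c| *
          ∑ a, ∑ b, |B c a * B d b - B c b * B d a| ≤ (2 * α) * (2 * β) := by
    calc _ ≤ ∑ c, ∑ d, |A u c * A v d - A u d * A v c| * (2 * β) := by
          refine Finset.sum_le_sum fun c _ => Finset.sum_le_sum fun d _ => ?_
          exact mul_le_mul_of_nonneg_left (hB c d) (abs_nonneg _)
      _ = (∑ c, ∑ d, |A u c * A v d - A u d * A v c|) * (2 * β) := by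
          simp only [Finset.sum_mul]
      _ ≤ _ := mul_le_mul_of_nonneg_right (hA u v) (by linarith)
  linarith

lemma WB_pow {A : Matrix V V ℝ} {α : ℝ} (hA : WB A α) (hα : 0 ≤ α) (k : ℕ) :
    WB (A ^ k) (α ^ k) := by
  induction k with
  | zero => simpa using WB_one
  | succ k ih => rw [pow_succ, pow_succ]; exact WB_mul ih hA hα

lemma WB_apply {A : Matrix V V ℝ} {α : ℝ} (hA : WB A α) (φ : V → V → ℝ)
    (hφ : ∀ a b, φ a b = - φ b a) (h1 : ∀ a b, |φ a b| ≤ 1) (u v : V) :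
    |∑ a, ∑ b, A u a * A v b * φ a b| ≤ α := by
  have h := wedge_id (A u) (A v) φ hφ
  have h2 : |2 * ∑ a, ∑ b, A u a * A v b * φ a b| ≤ 2 * α := by
    rw [h]
    refine le_trans ?_ (hA u v)
    refine (Finset.abs_sum_le_sum_abs _ _).trans (Finset.sum_le_sum fun c _ => ?_)
    refine (Finset.abs_sum_le_sum_abs _ _).trans (Finset.sum_le_sum fun d _ => ?_)
    rw [abs_mul]
    exact mul_le_of_le_one_right (abs_nonneg _) (h1 c d)
  rw [abs_mul] at h2
  norm_num at h2
  exact h2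

/-- Criterion for wedge contraction via overlap. -/
lemma WB_of_overlap {A : Matrix V V ℝ} (h0 : ∀ a b, 0 ≤ A a b) (hs : ∀ a, ∑ b, A a b ≤ 1)
    {δ : ℝ} (hδ : 0 ≤ δ) (hδ1 : δ ≤ 1)
    (ho : ∀ u v, (∀ a, A u a = 0) ∨ (∀ a, A v a = 0) ∨ δ ≤ ∑ a, min (A u a) (A v a)) :
    WB A (1 - δ ^ 2) := by
  intro u v
  have hδ2 : 0 ≤ 1 - δ ^ 2 := by nlinarith
  rcases ho u v with h | h | h
  · simp only [h, zero_mul, sub_zero, abs_zero, Finset.sum_const_zero]; linarith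
  · simp only [h, mul_zero, sub_zero, abs_zero, Finset.sum_const_zero]; linarith
  · have h1 : ∀ a b, |A u a * A v b - A u b * A v a| ≤ A u a * A v b + A u b * A v a
        - 2 * (min (A u a) (A v a) * min (A u b) (A v b)) := by
      intro a b
      have e1 : min (A u a) (A v a) * min (A u b) (A v b) ≤ A u a * A v b :=
        mul_le_mul (min_le_left _ _) (min_le_right _ _) (le_min (h0 _ _) (h0 _ _)) (h0 _ _)
      have e2 : min (A u a) (A v a) * min (A u b) (A v b) ≤ A u b * A v a := by
        rw [mul_comm (A u b)]
        exact mul_le_mul (min_le_right _ _) (min_le_left _ _) (le_min (h0 _ _) (h0 _ _)) (h0 _ _)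
      rw [abs_le]; constructor <;> linarith
    have h2 : ∑ a, ∑ b, (A u a * A v b + A u b * A v a
        - 2 * (min (A u a) (A v a) * min (A u b) (A v b)))
        = 2 * ((∑ a, A u a) * (∑ a, A v a)) - 2 * (∑ a, min (A u a) (A v a)) ^ 2 := by
      have e : ∑ a, ∑ b, A u b * A v a = (∑ a, A u a) * (∑ a, A v a) := by
        rw [Finset.sum_comm, Finset.sum_mul_sum]
      simp only [Finset.sum_sub_distrib, Finset.sum_add_distrib, ← Finset.mul_sum, sq]
      rw [e]
      simp only [← Finset.mul_sum, ← Finset.sum_mul]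
      ring
    have h3 : (∑ a, A u a) * (∑ a, A v a) ≤ 1 :=
      mul_le_one₀ (hs u) (Finset.sum_nonneg fun a _ => h0 v a) (hs v)
    have h4 : δ ^ 2 ≤ (∑ a, min (A u a) (A v a)) ^ 2 := pow_le_pow_left₀ hδ h 2
    calc _ ≤ _ := Finset.sum_le_sum fun a _ => Finset.sum_le_sum fun b _ => h1 a b
      _ ≤ _ := by rw [h2]; linarith

/-! ### The kernels -/

lemma K_nonneg (G : SimpleGraph V) (a b : V) : 0 ≤ K G a b := by
  unfold K; split_ifs <;> positivity

lemma K_sum (G : SimpleGraph V) (a : V) : ∑ b, K G a b = 1 := by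
  have h : ∀ b, K G a b = (if a = b then (if deg G a = 0 then 1 else 1 / 2) else 0)
      + (if G.Adj a b then 1 / (2 * (deg G a : ℝ)) else 0) := by
    intro b
    unfold K
    by_cases hab : a = b
    · subst hab; simp
    · simp [hab]
  rw [Finset.sum_congr rfl fun b _ => h b, Finset.sum_add_distrib]
  rw [Finset.sum_ite_eq, ← Finset.sum_filter, Finset.sum_const]
  change _ + (deg G a) • _ = _
  by_cases hd : deg G a = 0
  · simp [hd]
  · have : (deg G a : ℝ) ≠ 0 := by exact_mod_cast hd
    simp [hd]; field_simp; norm_num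

/-- The kernel as a matrix. -/
def PM (G : SimpleGraph V) : Matrix V V ℝ := Matrix.of (K G)

/-- The kernel killed upon leaving `y`. -/
def QM (G : SimpleGraph V) (y : V) : Matrix V V ℝ :=
  Matrix.of fun a b => if a = y then 0 else K G a b

/-- `P_x[τ(y) ≥ j]`. -/
def RR (G : SimpleGraph V) (y : V) (j : ℕ) (x : V) : ℝ := ∑ a, (QM G y ^ j) x a

lemma Kpow_eq (G : SimpleGraph V) (t : ℕ) (x y : V) : Kpow G t x y = (PM G ^ t) x y := by
  induction t generalizing y with
  | zero => simp [Kpow, Matrix.one_apply]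
  | succ t ih => rw [pow_succ, Matrix.mul_apply]; simp [Kpow, ih, PM]

lemma PM_nonneg (G : SimpleGraph V) (t : ℕ) (x y : V) : 0 ≤ (PM G ^ t) x y := by
  induction t generalizing y with
  | zero => simp only [pow_zero, Matrix.one_apply]; split_ifs <;> norm_num
  | succ t ih =>
    rw [pow_succ, Matrix.mul_apply]
    exact Finset.sum_nonneg fun z _ => mul_nonneg (ih z) (K_nonneg G _ _)

lemma PM_sum (G : SimpleGraph V) (t : ℕ) (x : V) : ∑ y, (PM G ^ t) x y = 1 := by
  induction t with
  | zero => simp [Matrix.one_apply]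
  | succ t ih =>
    simp only [pow_succ, Matrix.mul_apply]
    rw [Finset.sum_comm]
    simp only [← Finset.mul_sum]
    simpa [PM, K_sum] using ih

lemma QM_le (G : SimpleGraph V) (y a b : V) : QM G y a b ≤ PM G a b := by
  simp only [QM, PM, Matrix.of_apply]; split_ifs
  · exact K_nonneg G a b
  · exact le_rfl

lemma QM_nn1 (G : SimpleGraph V) (y a b : V) : 0 ≤ QM G y a b := by
  simp only [QM, Matrix.of_apply]; split_ifs
  · exact le_rfl
  · exact K_nonneg G a b

lemma QM_nonneg (G : SimpleGraph V) (y : V) (t : ℕ) (a b : V) : 0 ≤ (QM G y ^ t) a b := by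
  induction t generalizing b with
  | zero => simp only [pow_zero, Matrix.one_apply]; split_ifs <;> norm_num
  | succ t ih =>
    rw [pow_succ, Matrix.mul_apply]
    exact Finset.sum_nonneg fun z _ => mul_nonneg (ih z) (QM_nn1 G y _ _)

lemma QM_pow_le (G : SimpleGraph V) (y : V) (t : ℕ) (a b : V) :
    (QM G y ^ t) a b ≤ (PM G ^ t) a b := by
  induction t generalizing b with
  | zero => simp
  | succ t ih =>
    simp only [pow_succ, Matrix.mul_apply]
    exact Finset.sum_le_sum fun z _ =>
      mul_le_mul (ih z) (QM_le G y _ _) (QM_nn1 G y _ _) (PM_nonneg G t a z)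

lemma QM_sum (G : SimpleGraph V) (y a : V) : ∑ b, QM G y a b = if a = y then 0 else 1 := by
  simp only [QM, Matrix.of_apply]; split_ifs <;> simp [K_sum]

lemma QM_row_y (G : SimpleGraph V) (y : V) (t : ℕ) (ht : 0 < t) (b : V) :
    (QM G y ^ t) y b = 0 := by
  obtain ⟨s, rfl⟩ := Nat.exists_eq_add_of_lt ht
  rw [zero_add, pow_succ', Matrix.mul_apply]
  simp [QM]

lemma RR_zero (G : SimpleGraph V) (y x : V) : RR G y 0 x = 1 := by
  simp [RR, Matrix.one_apply]

lemma RR_add (G : SimpleGraph V) (y : V) (s j : ℕ) (x : V) :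
    RR G y (s + j) x = ∑ a, (QM G y ^ s) x a * RR G y j a := by
  simp only [RR, pow_add, Matrix.mul_apply]
  rw [Finset.sum_comm]
  simp only [Finset.mul_sum]

lemma RR_succ' (G : SimpleGraph V) (y : V) (j : ℕ) (x : V) :
    RR G y (j + 1) x = if x = y then 0 else ∑ w, K G x w * RR G y j w := by
  rw [add_comm, RR_add]
  simp only [pow_one, QM, Matrix.of_apply]
  split_ifs <;> simp

lemma RR_step (G : SimpleGraph V) (y : V) (j : ℕ) (x : V) :
    RR G y j x - RR G y (j + 1) x = (QM G y ^ j) x y := by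
  rw [RR_add, RR, ← Finset.sum_sub_distrib]
  have : ∀ a, RR G y 1 a = if a = y then 0 else 1 := by
    intro a; simp only [RR, pow_one]; exact QM_sum G y a
  simp only [this]
  rw [Finset.sum_eq_single y]
  · simp
  · intro b _ hb; simp [hb]
  · simp

lemma RR_nonneg (G : SimpleGraph V) (y : V) (j : ℕ) (x : V) : 0 ≤ RR G y j x :=
  Finset.sum_nonneg fun a _ => QM_nonneg G y j x a

lemma RR_anti (G : SimpleGraph V) (y : V) (j : ℕ) (x : V) : RR G y (j + 1) x ≤ RR G y j x := by
  have := RR_step G y j x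
  have := QM_nonneg G y j x y
  linarith

lemma RR_le_one (G : SimpleGraph V) (y : V) (j : ℕ) (x : V) : RR G y j x ≤ 1 := by
  induction j with
  | zero => rw [RR_zero]
  | succ j ih => exact (RR_anti G y j x).trans ih

lemma one_sub_RR (G : SimpleGraph V) (y : V) (m : ℕ) (w : V) :
    1 - RR G y m w ≤ ∑ t ∈ Finset.range m, (PM G ^ t) w y := by
  induction m with
  | zero => simp [RR_zero]
  | succ m ih =>
    rw [Finset.sum_range_succ]
    have := RR_step G y m w
    have := QM_pow_le G y m w y
    linarith

lemma KkillPow_zero (G : SimpleGraph V) (S : Finset V) (t : ℕ) (u a : V) (hu : u ∉ S)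
    (ha : a ∈ S) : KkillPow G S t u a = 0 := by
  cases t with
  | zero =>
    have : u ≠ a := fun h => hu (h ▸ ha)
    simp [KkillPow, this]
  | succ t => simp [KkillPow, Kkill, ha]

lemma KkillPow_le (G : SimpleGraph V) (S : Finset V) (y : V) (hy : y ∈ S) (t : ℕ) (u a : V)
    (hu : u ∉ S) : KkillPow G S t u a ≤ (QM G y ^ t) u a := by
  induction t generalizing a with
  | zero => simp [KkillPow, Matrix.one_apply]
  | succ t ih =>
    rw [pow_succ, Matrix.mul_apply]
    simp only [KkillPow]
    refine Finset.sum_le_sum fun w _ => ?_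
    by_cases hw : w ∈ S
    · rw [KkillPow_zero G S t u w hu hw, zero_mul]
      exact mul_nonneg (QM_nonneg G y t u w) (QM_nn1 G y w a)
    · have hwy : w ≠ y := fun h => hw (h ▸ hy)
      have h1 : Kkill G S w a ≤ QM G y w a := by
        simp only [Kkill, QM, Matrix.of_apply, hwy, if_false]
        split_ifs
        · exact K_nonneg G w a
        · exact le_rfl
      have h2 : 0 ≤ Kkill G S w a := by
        simp only [Kkill]; split_ifs
        · exact le_rfl
        · exact K_nonneg G w a
      exact mul_le_mul (ih w) h1 h2 (QM_nonneg G y t u w)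

lemma RR_of_hitBy (G : SimpleGraph V) {u y z : V} (h1 : u ≠ y) (h2 : u ≠ z) {T : ℕ} {ρ : ℝ}
    (h : hitBy G {y, z} u T ≤ ρ) : 1 - ρ ≤ RR G y T u := by
  have hu : u ∉ ({y, z} : Finset V) := by simp [h1, h2]
  unfold hitBy at h
  rw [if_neg hu] at h
  have : ∑ a, KkillPow G {y, z} T u a ≤ RR G y T u :=
    Finset.sum_le_sum fun a _ => KkillPow_le G {y, z} y (by simp) T u a hu
  linarith

/-- The contraction estimate. -/
lemma WB_main (G : SimpleGraph V) (y : V) (m : ℕ) (hm : 0 < m) (α : ℝ) (hα0 : 0 ≤ α) (hα1 : α ≤ 1)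
    (hmix : ∀ x y : V, |Kpow G m x y / unif V - 1| ≤ 1 / 4)
    (hR : ∀ u, u ≠ y → α ≤ RR G y m u)
    (hsmall : (m : ℝ) / Fintype.card V ≤ α / 10) :
    WB (QM G y ^ (2 * m)) (1 - (α / 2) ^ 2) := by
  have hc : 0 < (Fintype.card V : ℝ) := by
    have : Nonempty V := ⟨y⟩
    exact_mod_cast Fintype.card_pos
  set c : ℝ := (Fintype.card V : ℝ) with hcdef
  have hP : ∀ a b, 3 / 4 / c ≤ (PM G ^ m) a b ∧ (PM G ^ m) a b ≤ 5 / 4 / c := by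
    intro a b
    have h := abs_le.1 (hmix a b)
    rw [Kpow_eq, unif, div_inv_eq_mul] at h
    constructor
    · rw [div_le_iff₀ hc]; linarith [h.1]
    · rw [le_div_iff₀ hc]; linarith [h.2]
  have hP2 : ∀ t a b, (PM G ^ (t + m)) a b ≤ 5 / 4 / c := by
    intro t a b
    rw [pow_add, Matrix.mul_apply]
    calc _ ≤ ∑ w, (PM G ^ t) a w * (5 / 4 / c) :=
          Finset.sum_le_sum fun w _ => mul_le_mul_of_nonneg_left (hP w b).2 (PM_nonneg G t a w)
      _ = _ := by rw [← Finset.sum_mul, PM_sum, one_mul]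
  -- error term
  let e : V → V → ℝ := fun u a => ∑ w, (QM G y ^ m) u w * ((PM G ^ m) w a - (QM G y ^ m) w a)
  have he0 : ∀ u a, 0 ≤ e u a := fun u a => Finset.sum_nonneg fun w _ =>
    mul_nonneg (QM_nonneg G y m u w) (sub_nonneg.2 (QM_pow_le G y m w a))
  have hes : ∀ u, ∑ a, e u a ≤ α / 8 := by
    intro u
    calc ∑ a, e u a = ∑ w, (QM G y ^ m) u w * (1 - RR G y m w) := by
          simp only [e]
          rw [Finset.sum_comm]
          refine Finset.sum_congr rfl fun w _ => ?_
          rw [← Finset.mul_sum, Finset.sum_sub_distrib, PM_sum]; rfl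
      _ ≤ ∑ w, (PM G ^ m) u w * ∑ t ∈ Finset.range m, (PM G ^ t) w y := by
          refine Finset.sum_le_sum fun w _ => ?_
          exact mul_le_mul (QM_pow_le G y m u w) (one_sub_RR G y m w)
            (sub_nonneg.2 (RR_le_one G y m w)) (PM_nonneg G m u w)
      _ = ∑ t ∈ Finset.range m, (PM G ^ (t + m)) u y := by
          simp only [Finset.mul_sum]
          rw [Finset.sum_comm]
          refine Finset.sum_congr rfl fun t _ => ?_
          rw [add_comm, pow_add, Matrix.mul_apply]
      _ ≤ ∑ t ∈ Finset.range m, 5 / 4 / c := Finset.sum_le_sum fun t _ => hP2 t u y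
      _ = 5 / 4 * (m / c) := by simp; ring
      _ ≤ _ := by linarith
  have hlow : ∀ u, u ≠ y → ∀ a, 3 / 4 * α / c - e u a ≤ (QM G y ^ (2 * m)) u a := by
    intro u hu a
    have h1 : (QM G y ^ (2 * m)) u a = ∑ w, (QM G y ^ m) u w * (PM G ^ m) w a - e u a := by
      rw [two_mul, pow_add, Matrix.mul_apply]
      simp only [e]
      rw [← Finset.sum_sub_distrib]
      exact Finset.sum_congr rfl fun w _ => by ring
    have h2 : RR G y m u * (3 / 4 / c) ≤ ∑ w, (QM G y ^ m) u w * (PM G ^ m) w a := by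
      rw [RR, Finset.sum_mul]
      exact Finset.sum_le_sum fun w _ =>
        mul_le_mul_of_nonneg_left (hP w a).1 (QM_nonneg G y m u w)
    have h3 : α * (3 / 4 / c) ≤ RR G y m u * (3 / 4 / c) :=
      mul_le_mul_of_nonneg_right (hR u hu) (by positivity)
    have h4 : 3 / 4 * α / c = α * (3 / 4 / c) := by ring
    linarith
  refine WB_of_overlap (QM_nonneg G y _) (fun a => RR_le_one G y (2 * m) a) (by linarith)
    (by linarith) ?_
  intro u v
  by_cases hu : u = y
  · left; intro a; rw [hu]; exact QM_row_y G y _ (by omega) a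
  by_cases hv : v = y
  · right; left; intro a; rw [hv]; exact QM_row_y G y _ (by omega) a
  right; right
  have h1 : ∑ a : V, (3 / 4 * α / c - e u a - e v a) ≤
      ∑ a, min ((QM G y ^ (2 * m)) u a) ((QM G y ^ (2 * m)) v a) := by
    refine Finset.sum_le_sum fun a _ => le_min ?_ ?_
    · linarith [hlow u hu a, he0 v a]
    · linarith [hlow v hv a, he0 u a]
  refine le_trans ?_ h1
  rw [Finset.sum_sub_distrib, Finset.sum_sub_distrib]
  have h2 : ∑ a : V, 3 / 4 * α / c = 3 / 4 * α := by
    rw [Finset.sum_const, Finset.card_univ, nsmul_eq_mul, ← hcdef]; field_simp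
  rw [h2]
  linarith [hes u, hes v]

/-- Partial sums of the antisymmetric difference. -/
lemma partial_bound (G : SimpleGraph V) (y : V) (s p L : ℕ) (θ : ℝ)
    (h : WB (QM G y ^ s) θ) (x z : V) :
    |∑ i ∈ Finset.range L,
      ((RR G y (s + p + i) x - RR G y (s + p + i + 1) x) * RR G y (s + p + i + 1) z
       - (RR G y (s + p + i) z - RR G y (s + p + i + 1) z) * RR G y (s + p + i + 1) x)| ≤ θ := by
  let ψ : V → V → ℝ := fun a b => ∑ i ∈ Finset.range L,
    (RR G y (p + i) a - RR G y (p + i + 1) a) * RR G y (p + i + 1) b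
  have hψ : ∀ a b, 0 ≤ ψ a b ∧ ψ a b ≤ 1 := by
    intro a b
    constructor
    · exact Finset.sum_nonneg fun i _ =>
        mul_nonneg (sub_nonneg.2 (RR_anti G y _ a)) (RR_nonneg G y _ b)
    · calc ψ a b ≤ ∑ i ∈ Finset.range L, (RR G y (p + i) a - RR G y (p + (i + 1)) a) :=
            Finset.sum_le_sum fun i _ =>
              mul_le_of_le_one_right (sub_nonneg.2 (RR_anti G y _ a)) (RR_le_one G y _ b)
        _ = RR G y (p + 0) a - RR G y (p + L) a :=
            Finset.sum_range_sub' (fun i => RR G y (p + i) a) L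
        _ ≤ 1 := by linarith [RR_le_one G y (p + 0) a, RR_nonneg G y (p + L) a]
  have hb := WB_apply h (fun a b => ψ a b - ψ b a) (fun a b => by ring)
    (fun a b => by
      rw [abs_le]
      constructor <;> linarith [(hψ a b).1, (hψ a b).2, (hψ b a).1, (hψ b a).2]) x z
  convert hb using 2
  simp only [ψ, ← Finset.sum_sub_distrib, Finset.mul_sum]
  rw [Finset.sum_congr rfl fun a _ => Finset.sum_comm, Finset.sum_comm]
  refine Finset.sum_congr rfl fun i _ => ?_
  have e1 : ∀ w, RR G y (s + p + i) w = ∑ a, (QM G y ^ s) w a * RR G y (p + i) a := by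
    intro w; rw [add_assoc, RR_add]
  have e2 : ∀ w, RR G y (s + p + i + 1) w = ∑ a, (QM G y ^ s) w a * RR G y (p + i + 1) a := by
    intro w; rw [add_assoc, add_assoc, RR_add, add_assoc]
  rw [mul_comm (RR G y (s + p + i) z - RR G y (s + p + i + 1) z)]
  simp only [e1, e2, ← Finset.sum_sub_distrib, Finset.sum_mul_sum]
  refine Finset.sum_congr rfl fun a _ => ?_
  refine Finset.sum_congr rfl fun b _ => ?_
  ring

/-! ### Paths and measures -/

lemma path_sum (G : SimpleGraph V) (y : V) (n j : ℕ) (hj : j ≤ n + 1) (x : V) :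
    ∑ v : Fin (n + 1) → V, (delta x (v 0) * ∏ i : Fin n, K G (v i.castSucc) (v i.succ))
      * (if ∀ s : Fin (n + 1), (s : ℕ) < j → v s ≠ y then 1 else 0) = RR G y j x := by
  induction n generalizing j x with
  | zero =>
    rw [← (Equiv.funUnique (Fin 1) V).symm.sum_comp]
    simp only [Equiv.funUnique_symm_apply, Finset.univ_eq_empty, Finset.prod_empty, mul_one]
    rw [Finset.sum_eq_single x]
    · interval_cases j
      · simp [delta, RR_zero]
      · rw [RR_succ' G y 0 x]
        simp only [RR_zero, mul_one, K_sum]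
        by_cases h : x = y <;> simp [delta, h]
    · intro b _ hb; simp [delta, hb]
    · simp
  | succ n ih =>
    rw [← (Fin.consEquiv (fun _ : Fin (n + 2) => V)).sum_comp, Fintype.sum_prod_type]
    rw [Finset.sum_eq_single x]
    · have key : ∀ (k : ℕ), k ≤ n + 1 → ∑ v : Fin (n + 1) → V,
          (K G x (v 0) * ∏ i : Fin n, K G (v i.castSucc) (v i.succ))
          * (if ∀ s : Fin (n + 1), (s : ℕ) < k → v s ≠ y then 1 else 0)
          = ∑ w, K G x w * RR G y k w := by
        intro k hk
        simp only [← ih k hk, Finset.mul_sum]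
        rw [Finset.sum_comm]
        refine Finset.sum_congr rfl fun v _ => ?_
        rw [Finset.sum_eq_single (v 0)]
        · simp [delta]; 
        · intro b _ hb; simp [delta, hb.symm]
        · simp
      simp only [Fin.consEquiv_apply, Fin.cons_zero, Fin.prod_univ_succ, Fin.castSucc_zero,
        Fin.cons_succ, ← Fin.succ_castSucc]
      have hsp : ∀ v : Fin (n + 1) → V,
          (∀ s : Fin (n + 2), (s : ℕ) < j → (Fin.cons x v : Fin (n + 2) → V) s ≠ y) ↔
          ((0 < j → x ≠ y) ∧ ∀ s : Fin (n + 1), (s : ℕ) + 1 < j → v s ≠ y) := by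
        intro v; rw [Fin.forall_fin_succ]; simp
      simp only [hsp]
      cases j with
      | zero =>
        have := key 0 (by omega)
        simp only [RR_zero, mul_one, K_sum] at this ⊢
        simpa [delta] using this
      | succ j =>
        rw [RR_succ', ← key j (by omega)]
        by_cases h : x = y
        · simp [h]
        · simp [h, delta]
    · intro b _ hb; simp [delta, hb]
    · simp

lemma le_hitTime {Ω : Type*} (X : ℕ → Ω → V) (y : V) (ω : Ω) (j : ℕ) :
    (j : ℕ∞) ≤ hitTime X y ω ↔ ∀ s, s < j → X s ω ≠ y := by
  unfold hitTime
  rw [le_iInf₂_iff]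
  constructor
  · intro h s hs he
    have := h s he
    exact absurd (by exact_mod_cast this) (not_le.2 hs)
  · intro h s he
    by_contra hc
    have hc' : s < j := by
      rw [not_le] at hc; exact_mod_cast hc
    exact h s hc' he

lemma meas_le {Ω : Type*} [MeasurableSpace Ω] (X : ℕ → Ω → V) (y : V)
    (hm : ∀ t x, MeasurableSet {ω | X t ω = x}) (j : ℕ) :
    MeasurableSet {ω | (j : ℕ∞) ≤ hitTime X y ω} := by
  simp only [le_hitTime]
  rw [show {ω | ∀ s, s < j → X s ω ≠ y} = ⋂ s, ⋂ (_ : s < j), {ω | X s ω = y}ᶜ by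
    ext ω; simp]
  exact MeasurableSet.iInter fun s => MeasurableSet.iInter fun _ => (hm s y).compl

lemma IsWalkPair.swap {Ω : Type*} [MeasurableSpace Ω] {G : SimpleGraph V} {P : Measure Ω}
    {X₁ X₂ : ℕ → Ω → V} {i₁ i₂ : V → ℝ} (h : IsWalkPair G P X₁ X₂ i₁ i₂) :
    IsWalkPair G P X₂ X₁ i₂ i₁ where
  meas₁ := h.meas₂
  meas₂ := h.meas₁
  law := by
    intro n v w
    rw [mul_comm, ← h.law n w v]
    congr 2
    ext ω; exact and_comm

lemma joint_law {Ω : Type*} [MeasurableSpace Ω] {G : SimpleGraph V} {P : Measure Ω}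
    [IsProbabilityMeasure P]
    {X₁ X₂ : ℕ → Ω → V} {x z : V} (h : IsWalkPair G P X₁ X₂ (delta x) (delta z)) (y : V)
    (i j : ℕ) :
    P.real {ω | (i : ℕ∞) ≤ hitTime X₁ y ω ∧ (j : ℕ∞) ≤ hitTime X₂ y ω}
      = RR G y i x * RR G y j z := by
  obtain ⟨n, hi, hj⟩ : ∃ n, i ≤ n + 1 ∧ j ≤ n + 1 :=
    ⟨max i j, by omega, by omega⟩
  let Z : Ω → (Fin (n + 1) → V) × (Fin (n + 1) → V) :=
    fun ω => (fun s => X₁ s ω, fun s => X₂ s ω)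
  let ext' : (Fin (n + 1) → V) → ℕ → V := fun v s => if hs : s < n + 1 then v ⟨s, hs⟩ else v 0
  have hZ : ∀ p, Z ⁻¹' {p} = {ω | (∀ i ≤ n, X₁ i ω = ext' p.1 i) ∧ ∀ i ≤ n, X₂ i ω = ext' p.2 i} := by
    rintro ⟨v, w⟩
    ext ω
    simp only [Set.mem_preimage, Set.mem_singleton_iff, Set.mem_setOf_eq, Z, Prod.mk.injEq,
      funext_iff]
    have : ∀ (X : ℕ → Ω → V) (v : Fin (n + 1) → V),
        (∀ s : Fin (n + 1), X s ω = v s) ↔ ∀ i ≤ n, X i ω = ext' v i := by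
      intro X v
      constructor
      · intro hh i hi
        have : i < n + 1 := by omega
        simp only [ext', this, dif_pos]
        exact hh ⟨i, this⟩
      · intro hh s
        have := hh s (by omega)
        simpa only [ext', s.2, dif_pos] using this
    rw [this, this]
  have hmeas : ∀ p, MeasurableSet (Z ⁻¹' {p}) := by
    intro p
    rw [hZ]
    have : ∀ (X : ℕ → Ω → V) (v : ℕ → V), (∀ t x, MeasurableSet {ω | X t ω = x}) →
        MeasurableSet {ω | ∀ i ≤ n, X i ω = v i} := by
      intro X v hX
      rw [show {ω | ∀ i ≤ n, X i ω = v i} = ⋂ i, ⋂ (_ : i ≤ n), {ω | X i ω = v i} by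
        ext ω; simp]
      exact MeasurableSet.iInter fun s => MeasurableSet.iInter fun _ => hX s _
    exact (this X₁ _ h.meas₁).inter (this X₂ _ h.meas₂)
  have hwalk : ∀ (x : V) (v : Fin (n + 1) → V), walkP G (delta x) n (ext' v)
      = delta x (v 0) * ∏ i : Fin n, K G (v i.castSucc) (v i.succ) := by
    intro x v
    unfold walkP
    rw [Finset.prod_range]
    have h0 : ext' v 0 = v 0 := by simp [ext']
    rw [h0]
    congr 1
    refine Finset.prod_congr rfl fun i _ => ?_
    have h1 : (i : ℕ) < n + 1 := by omega
    have h2 : (i : ℕ) + 1 < n + 1 := by omega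
    simp only [ext', dif_pos h1, dif_pos h2]
    rfl
  have hp : ∀ p, P.real (Z ⁻¹' {p}) = (delta x (p.1 0) * ∏ i : Fin n, K G (p.1 i.castSucc) (p.1 i.succ))
      * (delta z (p.2 0) * ∏ i : Fin n, K G (p.2 i.castSucc) (p.2 i.succ)) := by
    intro p
    rw [hZ, ← hwalk, ← hwalk]
    exact h.law n _ _
  let A : Finset ((Fin (n + 1) → V) × (Fin (n + 1) → V)) := Finset.univ.filter fun p =>
    (∀ s : Fin (n + 1), (s : ℕ) < i → p.1 s ≠ y) ∧ (∀ s : Fin (n + 1), (s : ℕ) < j → p.2 s ≠ y)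
  have hset : {ω | (i : ℕ∞) ≤ hitTime X₁ y ω ∧ (j : ℕ∞) ≤ hitTime X₂ y ω} = ⋃ p ∈ A, Z ⁻¹' {p} := by
    ext ω
    simp only [le_hitTime, Set.mem_setOf_eq, Set.mem_iUnion, Set.mem_preimage,
      Set.mem_singleton_iff, exists_prop, exists_eq_right', A, Finset.mem_filter,
      Finset.mem_univ, true_and, Z]
    have : ∀ (X : ℕ → Ω → V) (k : ℕ), k ≤ n + 1 →
        ((∀ s, s < k → X s ω ≠ y) ↔ ∀ s : Fin (n + 1), (s : ℕ) < k → X s ω ≠ y) := by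
      intro X k hk
      constructor
      · intro hh s hs; exact hh s hs
      · intro hh s hs; exact hh ⟨s, by omega⟩ hs
    rw [this X₁ i hi, this X₂ j hj]
  rw [hset, measureReal_biUnion_finset]
  · rw [← path_sum G y n i hi x, ← path_sum G y n j hj z, Finset.sum_mul_sum]
    rw [Finset.sum_filter, Fintype.sum_prod_type]
    refine Finset.sum_congr rfl fun v _ => Finset.sum_congr rfl fun w _ => ?_
    rw [hp]
    by_cases h1 : ∀ s : Fin (n + 1), (s : ℕ) < i → v s ≠ y
    · by_cases h2 : ∀ s : Fin (n + 1), (s : ℕ) < j → w s ≠ y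
      · rw [if_pos ⟨h1, h2⟩, if_pos h1, if_pos h2]; ring
      · rw [if_neg (fun hh => h2 hh.2), if_neg h2]; ring
    · rw [if_neg (fun hh => h1 hh.1), if_neg h1]; ring
  · intro p _ q _ hpq
    refine Set.disjoint_left.2 fun ω h1 h2 => hpq ?_
    exact (h1 : Z ω = p).symm.trans h2
  · intro p _; exact hmeas p

lemma event_hasSum {Ω : Type*} [MeasurableSpace Ω] {G : SimpleGraph V} {P : Measure Ω}
    [IsProbabilityMeasure P]
    {X₁ X₂ : ℕ → Ω → V} {x z : V} (h : IsWalkPair G P X₁ X₂ (delta x) (delta z)) (y : V)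
    (g q : ℕ) (hq : q = g + 1) :
    HasSum (fun i => (RR G y (q + i) x - RR G y (q + i + 1) x) * RR G y (q + i + 1) z)
      (P {ω | (g : ℕ∞) < hitTime X₁ y ω ∧ hitTime X₁ y ω < hitTime X₂ y ω}).toReal := by
  let B : ℕ → ℕ → Set Ω := fun i j =>
    {ω | (i : ℕ∞) ≤ hitTime X₁ y ω ∧ (j : ℕ∞) ≤ hitTime X₂ y ω}
  have hB : ∀ i j, MeasurableSet (B i j) := fun i j =>
    (meas_le X₁ y h.meas₁ i).inter (meas_le X₂ y h.meas₂ j)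
  let D : ℕ → Set Ω := fun i => B (q + i) (q + i + 1) \ B (q + i + 1) (q + i + 1)
  have hDm : ∀ i, MeasurableSet (D i) := fun i => (hB _ _).diff (hB _ _)
  have hDmem : ∀ i ω, ω ∈ D i ↔ hitTime X₁ y ω = ((q + i : ℕ) : ℕ∞) ∧
      hitTime X₁ y ω < hitTime X₂ y ω := by
    intro i ω
    simp only [D, B, Set.mem_diff, Set.mem_setOf_eq]
    generalize hitTime X₁ y ω = a
    generalize hitTime X₂ y ω = b
    constructor
    · rintro ⟨⟨h1, h2⟩, h3⟩
      have h4 : ¬ ((q + i + 1 : ℕ) : ℕ∞) ≤ a := fun hh => h3 ⟨hh, h2⟩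
      have h5 : a = ((q + i : ℕ) : ℕ∞) := by
        rw [not_le] at h4
        refine le_antisymm ?_ h1
        exact Order.le_of_lt_succ (by simpa using h4)
      refine ⟨h5, ?_⟩
      rw [h5]
      refine lt_of_lt_of_le ?_ h2
      exact_mod_cast Nat.lt_succ_self _
    · rintro ⟨rfl, h2⟩
      have h3 : ((q + i + 1 : ℕ) : ℕ∞) ≤ b := by
        have := Order.add_one_le_of_lt h2
        simpa using this
      refine ⟨⟨le_rfl, h3⟩, fun hh => ?_⟩
      have := hh.1
      have : q + i + 1 ≤ q + i := by exact_mod_cast this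
      omega
  have hE : {ω | (g : ℕ∞) < hitTime X₁ y ω ∧ hitTime X₁ y ω < hitTime X₂ y ω} = ⋃ i, D i := by
    ext ω
    simp only [Set.mem_iUnion, hDmem, Set.mem_setOf_eq]
    constructor
    · rintro ⟨h1, h2⟩
      obtain ⟨t, ht⟩ := ENat.ne_top_iff_exists.1 h2.ne_top
      rw [← ht] at h1
      have h1' : g < t := by exact_mod_cast h1
      refine ⟨t - q, ?_, h2⟩
      rw [← ht]; congr 1; omega
    · rintro ⟨i, h1, h2⟩
      refine ⟨?_, h2⟩
      rw [h1]
      have : g < q + i := by omega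
      exact_mod_cast this
  have hdisj : Pairwise (Function.onFun Disjoint D) := by
    intro i j hij
    refine Set.disjoint_left.2 fun ω h1 h2 => hij ?_
    have e := ((hDmem i ω).1 h1).1.symm.trans ((hDmem j ω).1 h2).1
    have : q + i = q + j := by exact_mod_cast e
    omega
  have hD : ∀ i, (P (D i)).toReal
      = (RR G y (q + i) x - RR G y (q + i + 1) x) * RR G y (q + i + 1) z := by
    intro i
    change P.real (B _ _ \ B _ _) = _
    rw [measureReal_diff]
    · change P.real {ω | _} - P.real {ω | _} = _
      rw [joint_law h, joint_law h]; ring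
    · rintro ω ⟨h1, h2⟩
      refine ⟨le_trans ?_ h1, h2⟩
      exact_mod_cast Nat.le_succ _
    · exact hB _ _
  rw [hE, measure_iUnion hdisj hDm, ENNReal.tsum_toReal_eq fun i => measure_ne_top P _]
  simp only [← hD]
  refine ENNReal.hasSum_toReal ?_ 
  rw [← measure_iUnion hdisj hDm]
  exact measure_ne_top P _

lemma diff_bound {Ω : Type*} [MeasurableSpace Ω] {G : SimpleGraph V} {P : Measure Ω}
    [IsProbabilityMeasure P]
    {X₁ X₂ : ℕ → Ω → V} {x z : V} (h : IsWalkPair G P X₁ X₂ (delta x) (delta z)) (y : V)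
    (g s : ℕ) (hs : s ≤ g) (θ : ℝ) (hW : WB (QM G y ^ s) θ) :
    |(P {ω | (g : ℕ∞) < hitTime X₁ y ω ∧ hitTime X₁ y ω < hitTime X₂ y ω}).toReal
      - (P {ω | (g : ℕ∞) < hitTime X₂ y ω ∧ hitTime X₂ y ω < hitTime X₁ y ω}).toReal| ≤ θ := by
  obtain ⟨p, hp⟩ : ∃ p, s + p = g + 1 := ⟨g + 1 - s, by omega⟩
  have h1 := (event_hasSum h y g (s + p) hp).sub (event_hasSum h.swap y g (s + p) hp)
  refine le_of_tendsto h1.tendsto_sum_nat.abs (Eventually.of_forall fun L => ?_)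
  exact partial_bound G y s p L θ hW x z

/-- Lemma 17. Under Assumption 1, with
`Γ_n = c₀ T_mix log |V_n|` for a sufficiently large universal constant `c₀`,
`|P_{x,z}[Γ_n < τ₁(y) < τ₂(y)] - P_{x,z}[Γ_n < τ₂(y) < τ₁(y)]| ≤ C |V_n|^{-100}`. -/
theorem late_term_negligible
    (V : ℕ → Type) [∀ n, Fintype (V n)] (G : ∀ n, SimpleGraph (V n))
    (hA : Assumption1 V G)
    (Ωd : ℕ → Type) [∀ n, MeasurableSpace (Ωd n)]
    (Pd : ∀ n, V n → V n → Measure (Ωd n))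
    (hPd : ∀ n (x z : V n), IsProbabilityMeasure (Pd n x z))
    (Y₁ Y₂ : ∀ n, ℕ → Ωd n → V n)
    (hd : ∀ n (x z : V n), IsWalkPair (G n) (Pd n x z) (Y₁ n) (Y₂ n) (delta x) (delta z)) :
    ∃ c₀bar : ℝ, ∀ c₀ : ℝ, c₀bar ≤ c₀ → ∃ C > (0 : ℝ), ∀ n, ∀ x y z : V n,
      |(Pd n x z {ω | (gammaTime (G n) c₀ : ℕ∞) < hitTime (Y₁ n) y ω
            ∧ hitTime (Y₁ n) y ω < hitTime (Y₂ n) y ω}).toReal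
          - (Pd n x z {ω | (gammaTime (G n) c₀ : ℕ∞) < hitTime (Y₂ n) y ω
            ∧ hitTime (Y₂ n) y ω < hitTime (Y₁ n) y ω}).toReal|
        ≤ C / (Fintype.card (V n) : ℝ) ^ 100 := by
  obtain ⟨ρ, hρ, hhit⟩ := hA.hit_miss
  set α : ℝ := min (1 - ρ) 1 with hα
  have hα0 : 0 < α := lt_min (by linarith) one_pos
  have hα1 : α ≤ 1 := min_le_right _ _
  set θ : ℝ := 1 - (α / 2) ^ 2 with hθ
  have hθ1 : θ < 1 := by have : 0 < (α / 2) ^ 2 := by positivity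
                         linarith
  have hθ0 : 0 < θ := by nlinarith
  have hlog : Real.log θ < 0 := Real.log_neg hθ0 hθ1
  refine ⟨200 / (- Real.log θ), fun c₀ hc₀ => ?_⟩
  have hc₀pos : 0 < c₀ := lt_of_lt_of_le (div_pos (by norm_num) (by linarith)) hc₀
  have hc₀' : 200 ≤ c₀ * (- Real.log θ) := by
    rwa [div_le_iff₀ (by linarith)] at hc₀
  -- eventual facts
  have hev : ∀ᶠ n in atTop, 0 < Tmix (G n) ∧ 3 ≤ Fintype.card (V n) ∧
      (Tmix (G n) : ℝ) / Fintype.card (V n) ≤ α / 10 := by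
    have e1 := hA.tmix_top.eventually_ge_atTop 1
    have e2 := hA.card_top.eventually_ge_atTop 3
    have e3 := hA.tmix_small.eventually (ge_mem_nhds (show (0 : ℝ) < α / 10 by positivity))
    filter_upwards [e1, e2, e3] with n h1 h2 h3
    refine ⟨h1, h2, le_trans ?_ h3⟩
    have h4 : (1 : ℝ) ≤ Real.log (Fintype.card (V n)) := by
      rw [Real.le_log_iff_exp_le (by positivity)]
      have : (3 : ℝ) ≤ Fintype.card (V n) := by exact_mod_cast h2
      linarith [Real.exp_one_lt_d9]
    gcongr
    exact le_mul_of_one_le_right (Nat.cast_nonneg _) (one_le_pow₀ h4)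
  obtain ⟨N, hN⟩ := eventually_atTop.1 hev
  set C : ℝ := θ⁻¹ + ∑ n ∈ Finset.range N, (Fintype.card (V n) : ℝ) ^ 100 with hC
  have hCs : ∀ n < N, (Fintype.card (V n) : ℝ) ^ 100 ≤ C := by
    intro n hn
    have := Finset.single_le_sum (f := fun n => (Fintype.card (V n) : ℝ) ^ 100)
      (fun i _ => by positivity) (Finset.mem_range.2 hn)
    have h2 : 0 < θ⁻¹ := inv_pos.2 hθ0
    linarith
  have hCθ : θ⁻¹ ≤ C := by
    have : 0 ≤ ∑ n ∈ Finset.range N, (Fintype.card (V n) : ℝ) ^ 100 :=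
      Finset.sum_nonneg fun i _ => by positivity
    linarith
  refine ⟨C, lt_of_lt_of_le (inv_pos.2 hθ0) hCθ, fun n x y z => ?_⟩
  haveI := hPd n x z
  have hcpos : 0 < (Fintype.card (V n) : ℝ) := by
    have : Nonempty (V n) := ⟨y⟩
    exact_mod_cast Fintype.card_pos
  by_cases hn : n < N
  · refine (diff_bound (hd n x z) y _ 0 (Nat.zero_le _) 1 (by rw [pow_zero]; exact WB_one)).trans ?_
    rw [le_div_iff₀ (by positivity), one_mul]
    exact hCs n hn
  obtain ⟨hm, hcard, hsm⟩ := hN n (not_lt.1 hn)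
  have hmix : ∀ x y : V n, |Kpow (G n) (Tmix (G n)) x y / unif (V n) - 1| ≤ 1 / 4 := by
    have := Nat.sInf_mem (Nat.nonempty_of_pos_sInf (s := {t : ℕ | ∀ x y : V n,
      |Kpow (G n) t x y / unif (V n) - 1| ≤ 1 / 4}) hm)
    exact this
  have hR : ∀ u, u ≠ y → α ≤ RR (G n) y (Tmix (G n)) u := by
    intro u hu
    obtain ⟨w, hw⟩ : ∃ w, w ∉ ({u, y} : Finset (V n)) := by
      by_contra hcon
      push Not at hcon
      have : Fintype.card (V n) ≤ ({u, y} : Finset (V n)).card := by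
        rw [← Finset.card_univ]
        exact Finset.card_le_card fun a _ => hcon a
      have := Finset.card_le_two (a := u) (b := y)
      omega
    simp only [Finset.mem_insert, Finset.mem_singleton, not_or] at hw
    refine (min_le_left _ _).trans ?_
    exact RR_of_hitBy (G n) hu (Ne.symm hw.1)
      (hhit n u y w hu (Ne.symm hw.1) (Ne.symm hw.2))
  have hW := WB_main (G n) y (Tmix (G n)) hm α hα0.le hα1 hmix hR hsm
  set l : ℝ := Real.log (Fintype.card (V n)) with hl
  have hl0 : 0 ≤ l := Real.log_nonneg (by exact_mod_cast (by omega : 1 ≤ Fintype.card (V n)))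
  set k : ℕ := ⌊c₀ / 2 * l⌋₊ with hk
  have hk1 : (k : ℝ) ≤ c₀ / 2 * l := Nat.floor_le (by positivity)
  have hk2 : c₀ / 2 * l - 1 < k := Nat.sub_one_lt_floor _
  have hWk := WB_pow hW hθ0.le k
  rw [← pow_mul] at hWk
  have hs : 2 * Tmix (G n) * k ≤ gammaTime (G n) c₀ := by
    unfold gammaTime
    refine Nat.le_floor ?_
    push_cast
    have : (0 : ℝ) ≤ 2 * Tmix (G n) := by positivity
    nlinarith [mul_le_mul_of_nonneg_left hk1 this]
  refine (diff_bound (hd n x z) y _ _ hs _ hWk).trans ?_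
  rw [le_div_iff₀ (by positivity)]
  refine le_trans ?_ hCθ
  have e1 : θ ^ k = Real.exp (k * Real.log θ) := by
    rw [Real.exp_nat_mul, Real.exp_log hθ0]
  have e2 : (Fintype.card (V n) : ℝ) ^ 100 = Real.exp (100 * l) := by
    rw [show (100 : ℝ) = ((100 : ℕ) : ℝ) by norm_num, Real.exp_nat_mul, hl, Real.exp_log hcpos]
  have e3 : θ⁻¹ = Real.exp (- Real.log θ) := by
    rw [Real.exp_neg, Real.exp_log hθ0]
  change θ ^ k * _ ≤ _
  rw [e1, e2, e3, ← Real.exp_add, Real.exp_le_exp]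
  have f1 := mul_le_mul_of_nonneg_right hc₀' hl0
  have f2 := mul_le_mul_of_nonneg_right hk2.le (show 0 ≤ - Real.log θ by linarith)
  nlinarith

end RWPaint
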